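/- Let f : (0,∞) → ℝ be C². Then at every (z,t) ∈ ℝ^m × ℝ^k with z ≠ 0 one has 𝓑_γ(f ∘ ρ)(z,t) = ψ(z,t) ( f''(ρ(z,t)) + (Q−1) f'(ρ(z,t))/ρ(z,t) ). -/

import Mathlib

open MeasureTheory Real Set Filter Asymptotics

noncomputable section

/-- The underlying space ℝ^m × ℝ^k. -/
abbrev E (m k : ℕ) : Type :=
  EuclideanSpace ℝ (Fin m) × EuclideanSpace ℝ (Fin k)

namespace BG

variable {m k : ℕ}

/-- The Baouendi–Grushin gauge ρ. -/
def rho (γ : ℝ) (p : E m k) : ℝ :=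
  (‖p.1‖ ^ (2 * (γ + 1)) + (γ + 1) ^ 2 * ‖p.2‖ ^ 2) ^ (1 / (2 * (γ + 1)))

/-- The angle function ψ = |z|^{2γ}/ρ^{2γ}. -/
def psi (γ : ℝ) (p : E m k) : ℝ :=
  ‖p.1‖ ^ (2 * γ) / rho γ p ^ (2 * γ)

/-- The gauge ball B_r = {ρ < r}. -/
def ball (γ r : ℝ) : Set (E m k) := {p | rho γ p < r}

/-- The Baouendi–Grushin vector fields as direction fields:
X_i = ∂_{z_i} for i < m, X_{m+j} = |z|^γ ∂_{t_j}. -/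
def Xvec (γ : ℝ) (p : E m k) (i : Fin (m + k)) : E m k :=
  if h : (i : ℕ) < m then (EuclideanSpace.single ⟨(i : ℕ), h⟩ 1, 0)
  else (0, EuclideanSpace.single ⟨(i : ℕ) - m, by have := i.isLt; omega⟩ (‖p.1‖ ^ γ))

/-- Derivative along the i-th Baouendi–Grushin vector field. -/
def Xd (γ : ℝ) (i : Fin (m + k)) (f : E m k → ℝ) (p : E m k) : ℝ :=
  fderiv ℝ f p (Xvec γ p i)

/-- The quadratic form ⟨A Xu, Xu⟩. -/
def quadA (γ : ℝ) (A : E m k → Matrix (Fin (m + k)) (Fin (m + k)) ℝ)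
    (u : E m k → ℝ) (p : E m k) : ℝ :=
  ∑ i, ∑ j, A p i j * Xd γ i u p * Xd γ j u p

/-- μ = ⟨A Xρ, Xρ⟩. -/
def mu (γ : ℝ) (A : E m k → Matrix (Fin (m + k)) (Fin (m + k)) ℝ) (p : E m k) : ℝ :=
  quadA γ A (rho γ) p

/-- The operator 𝓛 u = Σ_{i,j} X_i(a_{ij} X_j u). -/
def Lop (γ : ℝ) (A : E m k → Matrix (Fin (m + k)) (Fin (m + k)) ℝ)
    (u : E m k → ℝ) (p : E m k) : ℝ :=
  ∑ i, ∑ j, Xd γ i (fun q => A q i j * Xd γ j u q) p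

/-- The vector field F = (ρ/μ) Σ a_{ij} X_iρ X_j, as a first order operator. -/
def Fop (γ : ℝ) (A : E m k → Matrix (Fin (m + k)) (Fin (m + k)) ℝ)
    (v : E m k → ℝ) (p : E m k) : ℝ :=
  rho γ p / mu γ A p * ∑ i, ∑ j, A p i j * Xd γ i (rho γ) p * Xd γ j v p

/-- The Baouendi–Grushin operator 𝓑_γ = Δ_z + |z|^{2γ} Δ_t = Σ_i X_i X_i. -/
def Bop (γ : ℝ) (u : E m k → ℝ) (p : E m k) : ℝ :=
  ∑ i : Fin (m + k), Xd γ i (Xd γ i u) p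

/-- The generator of anisotropic dilations Z = Σ z_i ∂_{z_i} + (γ+1) Σ t_j ∂_{t_j},
as a first order operator: the derivative in the direction (z, (γ+1) t). -/
def Zd (γ : ℝ) (v : E m k → ℝ) (p : E m k) : ℝ :=
  fderiv ℝ v p (p.1, (γ + 1) • p.2)

/-- The Euclidean divergence of a vector field on ℝ^m × ℝ^k. -/
def divV (V : E m k → E m k) (p : E m k) : ℝ :=
  (∑ i : Fin m, (fderiv ℝ V p (EuclideanSpace.single i 1, 0)).1 i) +
    ∑ j : Fin k,
      (fderiv ℝ V p ((0 : EuclideanSpace ℝ (Fin m)), EuclideanSpace.single j 1)).2 j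

/-- Uniform ellipticity: λ|η|² ≤ ⟨Aη,η⟩ ≤ λ⁻¹|η|². -/
def Elliptic (lam : ℝ) (A : E m k → Matrix (Fin (m + k)) (Fin (m + k)) ℝ) : Prop :=
  ∀ (p : E m k) (η : Fin (m + k) → ℝ),
    lam * ∑ i, η i ^ 2 ≤ ∑ i, ∑ j, A p i j * η i * η j ∧
      ∑ i, ∑ j, A p i j * η i * η j ≤ lam⁻¹ * ∑ i, η i ^ 2

/-- Symmetry of the matrix A. -/
def Symm (A : E m k → Matrix (Fin (m + k)) (Fin (m + k)) ℝ) : Prop :=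
  ∀ p i j, A p i j = A p j i

/-- The entries of A are C¹. -/
def C1coeff (A : E m k → Matrix (Fin (m + k)) (Fin (m + k)) ℝ) : Prop :=
  ∀ i j, ContDiff ℝ 1 fun p => A p i j

/-- The structural hypothesis (H) on B = A - I, in B_1. -/
def HypH (γ Λ : ℝ) (A : E m k → Matrix (Fin (m + k)) (Fin (m + k)) ℝ) : Prop :=
  ∀ p ∈ ball (m := m) (k := k) γ 1,
    (∀ i j : Fin (m + k),
        |(A p - 1) i j| ≤
          if (i : ℕ) < m ∧ (j : ℕ) < m then Λ * rho γ p
          else Λ * psi γ p ^ ((1 : ℝ) / 2 + 1 / (2 * γ)) * rho γ p) ∧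
      ∀ l i j : Fin (m + k),
        |Xd γ l (fun q => (A q - 1) i j) p| ≤
          if (l : ℕ) < m ∧ (i : ℕ) < m ∧ (j : ℕ) < m then Λ
          else if m ≤ (l : ℕ) ∧ (m ≤ (i : ℕ) ∨ m ≤ (j : ℕ)) then
            Λ * psi γ p ^ ((1 : ℝ) + 1 / (2 * γ))
          else Λ * psi γ p ^ ((1 : ℝ) / 2)

end BG

namespace BG

variable {m k : ℕ}

/-- The linear form `v ↦ a⟨z, v.1⟩ + b⟨t, v.2⟩`. -/
def linf (a b : ℝ) (p : E m k) : E m k →L[ℝ] ℝ :=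
  a • ((innerSL ℝ p.1).comp (ContinuousLinearMap.fst ℝ _ _)) +
  b • ((innerSL ℝ p.2).comp (ContinuousLinearMap.snd ℝ _ _))

lemma linf_apply (a b : ℝ) (p v : E m k) :
    linf a b p v = a * inner ℝ p.1 v.1 + b * inner ℝ p.2 v.2 := by
  simp [linf]

lemma inner_single_r {n : ℕ} (x : EuclideanSpace ℝ (Fin n)) (i : Fin n) (a : ℝ) :
    inner ℝ x (EuclideanSpace.single i a) = a * x i := by
  rw [EuclideanSpace.inner_single_right]
  simp

lemma hasFDerivAt_sq1 (p : E m k) :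
    HasFDerivAt (fun q : E m k => ‖q.1‖ ^ 2) (linf 2 0 p) p := by
  have h := (hasFDerivAt_fst (𝕜 := ℝ) (p := p)).norm_sq
  refine h.congr_fderiv (ContinuousLinearMap.ext fun v => ?_)
  rw [linf_apply]
  simp

lemma hasFDerivAt_sq2 (p : E m k) :
    HasFDerivAt (fun q : E m k => ‖q.2‖ ^ 2) (linf 0 2 p) p := by
  have h := (hasFDerivAt_snd (𝕜 := ℝ) (p := p)).norm_sq
  refine h.congr_fderiv (ContinuousLinearMap.ext fun v => ?_)
  rw [linf_apply]
  simp

lemma sq_rpow (x : ℝ) (hx : 0 ≤ x) (β : ℝ) : (x ^ 2) ^ (β / 2) = x ^ β := by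
  rw [← Real.rpow_natCast, ← Real.rpow_mul hx]
  congr 1
  push_cast
  ring

lemma hasFDerivAt_normpow (β : ℝ) (p : E m k) (hz : p.1 ≠ 0) :
    HasFDerivAt (fun q : E m k => ‖q.1‖ ^ β) (linf (β * ‖p.1‖ ^ (β - 2)) 0 p) p := by
  have h0 : 0 < ‖p.1‖ := norm_pos_iff.2 hz
  have h := (hasFDerivAt_sq1 p).rpow_const (p := β / 2) (Or.inl (by positivity))
  have e : (fun q : E m k => ‖q.1‖ ^ β) = fun q : E m k => (‖q.1‖ ^ 2) ^ (β / 2) := by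
    funext q
    rw [sq_rpow _ (norm_nonneg _)]
  rw [e]
  refine h.congr_fderiv (ContinuousLinearMap.ext fun v => ?_)
  have : (‖p.1‖ ^ 2) ^ (β / 2 - 1) = ‖p.1‖ ^ (β - 2) := by
    rw [← sq_rpow _ (norm_nonneg _)]
    congr 1
    ring
  simp only [_root_.smul_apply, linf_apply, this, smul_eq_mul]
  ring

lemma W_pos (γ : ℝ) (p : E m k) (hz : p.1 ≠ 0) :
    0 < ‖p.1‖ ^ (2 * (γ + 1)) + (γ + 1) ^ 2 * ‖p.2‖ ^ 2 := by
  have h0 : 0 < ‖p.1‖ := norm_pos_iff.2 hz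
  positivity

lemma rho_pos (γ : ℝ) (p : E m k) (hz : p.1 ≠ 0) : 0 < rho γ p :=
  Real.rpow_pos_of_pos (W_pos γ p hz) _

lemma rho_pow (γ : ℝ) (hγ : 0 < γ) (p : E m k) (hz : p.1 ≠ 0) :
    rho γ p ^ (2 * (γ + 1)) = ‖p.1‖ ^ (2 * (γ + 1)) + (γ + 1) ^ 2 * ‖p.2‖ ^ 2 := by
  unfold rho
  rw [← Real.rpow_mul (W_pos γ p hz).le, one_div, inv_mul_cancel₀ (by positivity), Real.rpow_one]

lemma hasFDerivAt_rho (γ : ℝ) (hγ : 0 < γ) (p : E m k) (hz : p.1 ≠ 0) :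
    HasFDerivAt (rho γ)
      (rho γ p ^ (-1 - 2 * γ) • linf (‖p.1‖ ^ (2 * γ)) (γ + 1) p) p := by
  have h := ((hasFDerivAt_normpow (2 * (γ + 1)) p hz).add
    ((hasFDerivAt_sq2 p).const_mul ((γ + 1) ^ 2))).rpow_const (p := 1 / (2 * (γ + 1)))
    (Or.inl (W_pos γ p hz).ne')
  refine HasFDerivAt.congr_fderiv h ?_
  refine ContinuousLinearMap.ext fun v => ?_
  have e1 : (‖p.1‖ ^ (2 * (γ + 1)) + (γ + 1) ^ 2 * ‖p.2‖ ^ 2) ^ (1 / (2 * (γ + 1)) - 1)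
      = rho γ p ^ (-1 - 2 * γ) := by
    unfold rho
    rw [← Real.rpow_mul (W_pos γ p hz).le]
    congr 1
    field_simp
    ring
  have e2 : 2 * (γ + 1) - 2 = 2 * γ := by ring
  simp only [Pi.add_apply, _root_.smul_apply, _root_.add_apply, linf_apply, e1, e2,
    smul_eq_mul]
  field_simp
  ring

lemma ev_ne (p : E m k) (hz : p.1 ≠ 0) : ∀ᶠ q : E m k in nhds p, q.1 ≠ 0 :=
  continuous_fst.continuousAt.eventually_ne hz

/-- first derivative along X -/
lemma fderiv_comp (γ : ℝ) (hγ : 0 < γ) (f : ℝ → ℝ) (hf : ContDiffOn ℝ 2 f (Set.Ioi 0))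
    (p : E m k) (hz : p.1 ≠ 0) :
    fderiv ℝ (fun q => f (rho γ q)) p =
      (deriv f (rho γ p) * rho γ p ^ (-1 - 2 * γ)) • linf (‖p.1‖ ^ (2 * γ)) (γ + 1) p := by
  have hd : HasDerivAt f (deriv f (rho γ p)) (rho γ p) :=
    ((hf.contDiffAt (Ioi_mem_nhds (rho_pos γ p hz))).differentiableAt
      (by norm_num)).hasDerivAt
  have := (hd.comp_hasFDerivAt p (hasFDerivAt_rho γ hγ p hz)).fderiv
  rw [smul_smul] at this
  exact this

/-- derivative of g(rho) -/
lemma hasFDerivAt_g (γ : ℝ) (hγ : 0 < γ) (f : ℝ → ℝ) (hf : ContDiffOn ℝ 2 f (Set.Ioi 0))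
    (p : E m k) (hz : p.1 ≠ 0) :
    HasFDerivAt (fun q : E m k => deriv f (rho γ q) * rho γ q ^ (-1 - 2 * γ))
      (((deriv (deriv f) (rho γ p) * rho γ p ^ (-1 - 2 * γ)
        + deriv f (rho γ p) * ((-1 - 2 * γ) * rho γ p ^ (-1 - 2 * γ - 1))) *
          rho γ p ^ (-1 - 2 * γ)) • linf (‖p.1‖ ^ (2 * γ)) (γ + 1) p) p := by
  have hr := rho_pos γ p hz
  have h1 : ContDiffOn ℝ 1 (deriv f) (Set.Ioi 0) :=
    ((contDiffOn_succ_iff_deriv_of_isOpen (n := 1) isOpen_Ioi).1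
      (by simpa [one_add_one_eq_two] using hf)).2.2
  have hd : HasDerivAt (deriv f) (deriv (deriv f) (rho γ p)) (rho γ p) :=
    ((h1.contDiffAt (Ioi_mem_nhds hr)).differentiableAt (by norm_num)).hasDerivAt
  have hp := Real.hasDerivAt_rpow_const (x := rho γ p) (p := -1 - 2 * γ) (Or.inl hr.ne')
  have := (hd.mul hp).comp_hasFDerivAt p (hasFDerivAt_rho γ hγ p hz)
  rw [smul_smul] at this
  exact this

lemma Xvec_castAdd (γ : ℝ) (p : E m k) (i : Fin m) :
    Xvec γ p (Fin.castAdd k i) = (EuclideanSpace.single i 1, 0) := by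
  simp [Xvec]

lemma Xvec_natAdd (γ : ℝ) (p : E m k) (j : Fin k) :
    Xvec γ p (Fin.natAdd m j) = (0, EuclideanSpace.single j (‖p.1‖ ^ γ)) := by
  simp [Xvec]

lemma norm_sq_mul (x : ℝ) (hx : 0 < x) (γ : ℝ) : x ^ γ * x ^ γ = x ^ (2 * γ) := by
  rw [← Real.rpow_add hx]
  congr 1
  ring

/-- derivative of the coordinate functions -/
lemma hasFDerivAt_c1 (p : E m k) (i : Fin m) :
    HasFDerivAt (fun q : E m k => q.1 i)
      ((EuclideanSpace.proj i : EuclideanSpace ℝ (Fin m) →L[ℝ] ℝ).comp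
        (ContinuousLinearMap.fst ℝ _ _)) p :=
  ((EuclideanSpace.proj i : EuclideanSpace ℝ (Fin m) →L[ℝ] ℝ).comp
        (ContinuousLinearMap.fst ℝ _ (EuclideanSpace ℝ (Fin k)))).hasFDerivAt

lemma hasFDerivAt_c2 (p : E m k) (i : Fin k) :
    HasFDerivAt (fun q : E m k => q.2 i)
      ((EuclideanSpace.proj i : EuclideanSpace ℝ (Fin k) →L[ℝ] ℝ).comp
        (ContinuousLinearMap.snd ℝ _ _)) p :=
  ((EuclideanSpace.proj i : EuclideanSpace ℝ (Fin k) →L[ℝ] ℝ).comp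
        (ContinuousLinearMap.snd ℝ (EuclideanSpace ℝ (Fin m)) _)).hasFDerivAt

lemma XX1 (γ : ℝ) (hγ : 0 < γ) (f : ℝ → ℝ) (hf : ContDiffOn ℝ 2 f (Set.Ioi 0))
    (p : E m k) (hz : p.1 ≠ 0) (i : Fin m) :
    Xd γ (Fin.castAdd k i) (Xd γ (Fin.castAdd k i) (fun q => f (rho γ q))) p =
      (((deriv (deriv f) (rho γ p) * rho γ p ^ (-1 - 2 * γ)
        + deriv f (rho γ p) * ((-1 - 2 * γ) * rho γ p ^ (-1 - 2 * γ - 1))) *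
          rho γ p ^ (-1 - 2 * γ)) * (‖p.1‖ ^ (2 * γ) * ‖p.1‖ ^ (2 * γ))
       + deriv f (rho γ p) * rho γ p ^ (-1 - 2 * γ) * (2 * γ * ‖p.1‖ ^ (2 * γ - 2)))
          * p.1 i ^ 2
      + deriv f (rho γ p) * rho γ p ^ (-1 - 2 * γ) * ‖p.1‖ ^ (2 * γ) := by
  have hev : Xd γ (Fin.castAdd k i) (fun q : E m k => f (rho γ q)) =ᶠ[nhds p]
      fun q => (deriv f (rho γ q) * rho γ q ^ (-1 - 2 * γ)) * (‖q.1‖ ^ (2 * γ) * q.1 i) := by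
    filter_upwards [ev_ne p hz] with q hq
    rw [Xd, fderiv_comp γ hγ f hf q hq, Xvec_castAdd, _root_.smul_apply, linf_apply]
    simp [inner_single_r]
  have h := (hasFDerivAt_g γ hγ f hf p hz).mul
    ((hasFDerivAt_normpow (2 * γ) p hz).mul (hasFDerivAt_c1 p i))
  have h2 := (hev.fderiv_eq (𝕜 := ℝ)).trans h.fderiv
  rw [Xd, h2, Xvec_castAdd]
  simp only [_root_.smul_apply, _root_.add_apply, linf_apply, smul_eq_mul]
  simp [inner_single_r]
  ring

lemma XX2 (γ : ℝ) (hγ : 0 < γ) (f : ℝ → ℝ) (hf : ContDiffOn ℝ 2 f (Set.Ioi 0))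
    (p : E m k) (hz : p.1 ≠ 0) (i : Fin k) :
    Xd γ (Fin.natAdd m i) (Xd γ (Fin.natAdd m i) (fun q => f (rho γ q))) p =
      ((deriv (deriv f) (rho γ p) * rho γ p ^ (-1 - 2 * γ)
        + deriv f (rho γ p) * ((-1 - 2 * γ) * rho γ p ^ (-1 - 2 * γ - 1))) *
          rho γ p ^ (-1 - 2 * γ)) * ((γ + 1) ^ 2 * ‖p.1‖ ^ (2 * γ)) * p.2 i ^ 2
      + deriv f (rho γ p) * rho γ p ^ (-1 - 2 * γ) * ((γ + 1) * ‖p.1‖ ^ (2 * γ)) := by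
  have hev : Xd γ (Fin.natAdd m i) (fun q : E m k => f (rho γ q)) =ᶠ[nhds p]
      fun q => (deriv f (rho γ q) * rho γ q ^ (-1 - 2 * γ)) *
        (‖q.1‖ ^ γ * ((γ + 1) * q.2 i)) := by
    filter_upwards [ev_ne p hz] with q hq
    rw [Xd, fderiv_comp γ hγ f hf q hq, Xvec_natAdd, _root_.smul_apply, linf_apply]
    simp only [inner_single_r, inner_zero_right, smul_eq_mul]
    ring
  have h := (hasFDerivAt_g γ hγ f hf p hz).mul
    ((hasFDerivAt_normpow γ p hz).mul ((hasFDerivAt_c2 p i).const_mul (γ + 1)))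
  have h2 := (hev.fderiv_eq (𝕜 := ℝ)).trans h.fderiv
  rw [Xd, h2, Xvec_natAdd, ← norm_sq_mul _ (norm_pos_iff.2 hz) γ]
  simp only [_root_.smul_apply, _root_.add_apply, linf_apply, smul_eq_mul]
  simp [inner_single_r]
  ring

end BG

open BG in
/-- the radial formula 𝓑_γ f(ρ) = ψ (f'' + (Q-1) f'/ρ)
(identity (2.11) of the paper). -/
theorem grushin_radial_formula
    (m k : ℕ) (hm : 1 ≤ m) (hk : 1 ≤ k) (γ : ℝ) (hγ : 0 < γ)
    (f : ℝ → ℝ) (hf : ContDiffOn ℝ 2 f (Set.Ioi 0))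
    (p : E m k) (hz : p.1 ≠ 0) :
    Bop γ (fun q => f (rho γ q)) p
      = psi γ p * (deriv (deriv f) (rho γ p)
          + ((m : ℝ) + (γ + 1) * k - 1) * deriv f (rho γ p) / rho γ p) := by
  have h0 : 0 < ‖p.1‖ := norm_pos_iff.2 hz
  have hr := rho_pos γ p hz
  have s1 : ∑ i, p.1 i ^ 2 = ‖p.1‖ ^ 2 := (EuclideanSpace.real_norm_sq_eq p.1).symm
  have s2 : ∑ i, p.2 i ^ 2 = ‖p.2‖ ^ 2 := (EuclideanSpace.real_norm_sq_eq p.2).symm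
  have hW := rho_pow γ hγ p hz
  rw [Bop, Fin.sum_univ_add]
  simp only [XX1 γ hγ f hf p hz, XX2 γ hγ f hf p hz, Finset.sum_add_distrib, ← Finset.mul_sum,
    s1, s2, Finset.sum_const, Finset.card_univ, Fintype.card_fin, nsmul_eq_mul, psi]
  have e1 : rho γ p ^ (-1 - 2 * γ) = (rho γ p)⁻¹ * (rho γ p ^ (2 * γ))⁻¹ := by
    rw [Real.rpow_sub hr, Real.rpow_neg_one, div_eq_mul_inv]
  have e2 : rho γ p ^ (-1 - 2 * γ - 1) = (rho γ p)⁻¹ * (rho γ p ^ (2 * γ))⁻¹ * (rho γ p)⁻¹ := by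
    rw [Real.rpow_sub hr, e1, Real.rpow_one, div_eq_mul_inv]
  have e3 : rho γ p ^ (2 * (γ + 1)) = rho γ p ^ (2 * γ) * rho γ p ^ 2 := by
    rw [← Real.rpow_natCast, ← Real.rpow_add hr]; congr 1; push_cast; ring
  have e4 : ‖p.1‖ ^ (2 * (γ + 1)) = ‖p.1‖ ^ (2 * γ) * ‖p.1‖ ^ 2 := by
    rw [← Real.rpow_natCast, ← Real.rpow_add h0]; congr 1; push_cast; ring
  have e5 : ‖p.1‖ ^ (2 * γ - 2) = ‖p.1‖ ^ (2 * γ) / ‖p.1‖ ^ 2 := by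
    rw [Real.rpow_sub h0]; norm_num
  rw [e3, e4] at hW
  rw [e1, e2, e5]
  have hR : 0 < rho γ p ^ (2 * γ) := Real.rpow_pos_of_pos hr _
  have hN : 0 < ‖p.1‖ ^ (2 * γ) := Real.rpow_pos_of_pos h0 _
  generalize rho γ p ^ (2 * γ) = R at *
  generalize ‖p.1‖ ^ (2 * γ) = n at *
  generalize rho γ p = r at *
  generalize ‖p.1‖ = x at *
  generalize ‖p.2‖ = y at *
  generalize deriv (deriv f) r = F2
  generalize deriv f r = F1
  have hy : (γ + 1) ^ 2 * y ^ 2 = R * r ^ 2 - n * x ^ 2 := by linarith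
  have key : ∀ G : ℝ, G * ((γ + 1) ^ 2 * n) * y ^ 2 = G * n * (R * r ^ 2 - n * x ^ 2) := by
    intro G; rw [← hy]; ring
  rw [key]
  field_simp
  ring
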